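/- Let A be a finite group. For a regular subset S ∈ Ss_A and f ∈ Aut(A), set n^S_f := |{a ∈ A : (a,f) ∈ S}|. If S and S' lie in the same connected component of the quiver of Ss_A, then the multisets {n^S_f : f ∈ Aut(A)} and {n^{S'}_f : f ∈ Aut(A)} coincide; in particular, the partition part(S) of |A| formed by arranging the numbers n^S_f in decreasing order depends only on the connected component of Ss_A containing S. -/

import Mathlib

/-- The holomorph `Hol(A) = A ⋊ Aut(A)`, with `Aut(A)` acting on `A` by evaluation;
elements are pairs `⟨a, f⟩` with multiplication `⟨a,f⟩⟨b,g⟩ = ⟨a·f(b), f∘g⟩`. -/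
abbrev Hol (A : Type u) [Group A] :=
  SemidirectProduct A (MulAut A) (MonoidHom.id (MulAut A))

/-- A subset `S ⊆ Hol(A)` is regular if for every `a ∈ A` there is a unique
`f ∈ Aut(A)` with `(a, f) ∈ S`. -/
def IsRegularSubset {A : Type u} [Group A] (S : Set (Hol A)) : Prop :=
  ∀ a : A, ∃! f : MulAut A, (⟨a, f⟩ : Hol A) ∈ S

/-- For a subset `S ⊆ Hol(A)` and a label `a ∈ A`, the translate
`(a, f^S_a)⁻¹ • S` (for `S` regular, `f^S_a` is the unique automorphism paired with
`a`); this is the target of the arrow with source `S` and label `a` in the quiver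
associated with a family of regular subsets. -/
def trg {A : Type u} [Group A] (S : Set (Hol A)) (a : A) : Set (Hol A) :=
  {β : Hol A | ∃ f : MulAut A, (⟨a, f⟩ : Hol A) ∈ S ∧ (⟨a, f⟩ : Hol A) * β ∈ S}

/-- Adjacency in the quiver of `Ss_A`, whose vertices are all the regular subsets of
`Hol(A)` and whose arrows go from `S` to `(a, f^S_a)⁻¹ S` for each `a ∈ A`. -/
def adjA {A : Type u} [Group A] (S S' : Set (Hol A)) : Prop :=
  IsRegularSubset S ∧ IsRegularSubset S' ∧ ∃ a : A, trg S a = S'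

/-- If `⟨a, f⟩` lies in the regular subset `S`, membership in the translate `trg S a` is
membership of the left multiple by `⟨a, f⟩` in `S`. -/
theorem IsRegularSubset.mem_trg_iff {A : Type u} [Group A] {S : Set (Hol A)}
    (hS : IsRegularSubset S) {a : A} {f : MulAut A} (hf : (⟨a, f⟩ : Hol A) ∈ S) (β : Hol A) :
    β ∈ trg S a ↔ (⟨a, f⟩ : Hol A) * β ∈ S := by
  refine ⟨?_, fun h => ⟨f, hf, h⟩⟩
  rintro ⟨g, hg, h⟩
  rwa [(hS a).unique hf hg]

/-- Translating a regular subset permutes the cardinalities of its fibres over `MulAut A`. -/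
theorem IsRegularSubset.exists_equiv_card_fiber_trg {A : Type u} [Group A] {S : Set (Hol A)}
    (hS : IsRegularSubset S) (a : A) :
    ∃ e : MulAut A ≃ MulAut A, ∀ f : MulAut A,
      Nat.card {b : A // (⟨b, e f⟩ : Hol A) ∈ trg S a} =
        Nat.card {b : A // (⟨b, f⟩ : Hol A) ∈ S} := by
  obtain ⟨f, hf, -⟩ := hS a
  refine ⟨Equiv.mulLeft f⁻¹, fun g => Nat.card_congr <|
    (f.toEquiv.trans (Equiv.mulLeft a)).subtypeEquiv fun b => ?_⟩
  have key : (⟨a, f⟩ : Hol A) * ⟨b, Equiv.mulLeft f⁻¹ g⟩ = ⟨a * f b, g⟩ := by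
    ext1 <;> simp
  rw [hS.mem_trg_iff hf, key]
  rfl

/-- Let `A` be a finite group. For a regular subset `S` of `Hol(A)`
and `f ∈ Aut(A)`, let `n^S_f := |{a ∈ A : (a,f) ∈ S}|`. If `S, S'` are regular and
lie in the same connected component of the quiver of `Ss_A`, then the multisets
`{n^S_f}` and `{n^{S'}_f}` coincide (there is a bijection `e` of `Aut(A)` with
`n^{S'}_{e f} = n^S_f` for all `f`); in particular the partition `part(S)` of `|A|`
depends only on the connected component containing `S`. -/
theorem partition_constant_on_components {A : Type u} [Group A] [Fintype A]
    (S S' : Set (Hol A)) (hS : IsRegularSubset S) (hS' : IsRegularSubset S')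
    (h : Relation.EqvGen adjA S S') :
    ∃ e : MulAut A ≃ MulAut A, ∀ f : MulAut A,
      Nat.card {a : A // (⟨a, e f⟩ : Hol A) ∈ S'} =
        Nat.card {a : A // (⟨a, f⟩ : Hol A) ∈ S} := by
  clear hS hS'
  induction h with
  | rel S S' h =>
    obtain ⟨hS, -, a, rfl⟩ := h
    exact hS.exists_equiv_card_fiber_trg a
  | refl S => exact ⟨Equiv.refl _, fun _ => rfl⟩
  | symm S S' _ ih =>
    obtain ⟨e, he⟩ := ih
    exact ⟨e.symm, fun f => by simpa using (he (e.symm f)).symm⟩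
  | trans S T S' _ _ ih₁ ih₂ =>
    obtain ⟨e₁, h₁⟩ := ih₁
    obtain ⟨e₂, h₂⟩ := ih₂
    exact ⟨e₁.trans e₂, fun f => (h₂ (e₁ f)).trans (h₁ f)⟩
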